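/- Gaussian complexity bound for the fully penalized error cone: Let f and g be norms on ℝ^n and ℝ^m, x* ∈ ℝ^n, v* ∈ ℝ^m, τ₁, τ₂ > 0, β > 1, and let C₃(x*,v*) := {(a,b) ∈ ℝ^n × ℝ^m : τ₁⟨a,u⟩ + τ₂⟨b,s⟩ ≤ (1/β)[τ₁ f(a) + τ₂ g(b)] for all u ∈ ∂f(x*) and all s ∈ ∂g(v*)}. Then γ(C₃(x*,v*) ∩ S^{n+m−1}) ≤ 2 [ √( η²(τ₁·∂f(x*)) + η²(τ₂·∂g(v*)) ) + √((τ₁ α_f)² + (τ₂ α_g)²)/β ] + 1, where α_f := sup_{u≠0} f(u)/‖u‖₂ and α_g := sup_{u≠0} g(u)/‖u‖₂. -/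

import Mathlib

open MeasureTheory ProbabilityTheory

noncomputable section

/-- Squared Euclidean norm of a vector in `ι → ℝ`. -/
def sqNorm {ι : Type*} [Fintype ι] (x : ι → ℝ) : ℝ := ∑ i, (x i) ^ 2

/-- Euclidean norm of a vector in `ι → ℝ`. -/
def eNorm {ι : Type*} [Fintype ι] (x : ι → ℝ) : ℝ := Real.sqrt (sqNorm x)

/-- Euclidean inner product. -/
def dotp {ι : Type*} [Fintype ι] (x y : ι → ℝ) : ℝ := ∑ i, x i * y i

/-- Sub-Gaussian (ψ₂, Orlicz) norm of a real random variable. -/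
def psi2Norm {Ω : Type*} [MeasurableSpace Ω] (μ : Measure Ω) (X : Ω → ℝ) : ℝ :=
  sInf {K : ℝ | 0 < K ∧ ∫ ω, Real.exp ((X ω) ^ 2 / K ^ 2) ∂μ ≤ 2}

/-- Sub-Gaussian (ψ₂) norm of a random vector: supremum of ψ₂ norms of its
one-dimensional marginals over the unit sphere. -/
def vecPsi2Norm {Ω : Type*} [MeasurableSpace Ω] {ι : Type*} [Fintype ι]
    (μ : Measure Ω) (X : Ω → ι → ℝ) : ℝ :=
  sSup {c : ℝ | ∃ y : ι → ℝ, sqNorm y = 1 ∧ c = psi2Norm μ (fun ω => dotp (X ω) y)}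

/-- A random vector is centered if each coordinate has zero mean. -/
def IsCentered {Ω : Type*} [MeasurableSpace Ω] {ι : Type*} [Fintype ι]
    (μ : Measure Ω) (X : Ω → ι → ℝ) : Prop :=
  ∀ i, ∫ ω, X ω i ∂μ = 0

/-- A random vector is isotropic if its second moment matrix is the identity. -/
def IsIsotropic {Ω : Type*} [MeasurableSpace Ω] {ι : Type*} [Fintype ι] [DecidableEq ι]
    (μ : Measure Ω) (X : Ω → ι → ℝ) : Prop :=
  ∀ i j, ∫ ω, X ω i * X ω j ∂μ = if i = j then (1 : ℝ) else 0

/-- Standard Gaussian measure on `ι → ℝ`. -/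
def stdGaussian (ι : Type*) [Fintype ι] : Measure (ι → ℝ) :=
  Measure.pi fun _ => gaussianReal 0 1

/-- Gaussian complexity `γ(T) = E sup_{x ∈ T} |⟨g, x⟩|`. -/
def gaussComplexity {ι : Type*} [Fintype ι] (T : Set (ι → ℝ)) : ℝ :=
  ∫ g, sSup ((fun x => |dotp g x|) '' T) ∂(stdGaussian ι)

/-- Gaussian width `ω(T) = E sup_{x ∈ T} ⟨g, x⟩`. -/
def gaussWidth {ι : Type*} [Fintype ι] (T : Set (ι → ℝ)) : ℝ :=
  ∫ g, sSup ((fun x => dotp g x) '' T) ∂(stdGaussian ι)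

/-- Gaussian squared distance `η²(T) = E inf_{u ∈ T} ‖g - u‖₂²`. -/
def gaussSqDist {ι : Type*} [Fintype ι] (T : Set (ι → ℝ)) : ℝ :=
  ∫ g, sInf ((fun u => sqNorm (g - u)) '' T) ∂(stdGaussian ι)

/-- Radius `rad(T) = sup_{x ∈ T} ‖x‖₂`. -/
def radius {ι : Type*} [Fintype ι] (T : Set (ι → ℝ)) : ℝ :=
  sSup (eNorm '' T)

/-- Euclidean boundedness of a set. -/
def EBounded {ι : Type*} [Fintype ι] (T : Set (ι → ℝ)) : Prop :=
  ∃ R : ℝ, ∀ x ∈ T, eNorm x ≤ R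

/-- Unit Euclidean sphere in `ι → ℝ`. -/
def unitSphere (ι : Type*) [Fintype ι] : Set (ι → ℝ) := {x | sqNorm x = 1}

/-- Identify a pair `(a, b) ∈ ℝ^n × ℝ^m` with the concatenated vector in `ℝ^{n+m}`. -/
def pairVec {n m : ℕ} (p : (Fin n → ℝ) × (Fin m → ℝ)) : (Fin n ⊕ Fin m) → ℝ :=
  Sum.elim p.1 p.2

/-- Image of a set of pairs under concatenation. -/
def pairSet {n m : ℕ} (T : Set ((Fin n → ℝ) × (Fin m → ℝ))) : Set ((Fin n ⊕ Fin m) → ℝ) :=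
  pairVec '' T

/-- Intersection of a set of pairs (viewed in `ℝ^{n+m}`) with the unit sphere. -/
def sphPair {n m : ℕ} (T : Set ((Fin n → ℝ) × (Fin m → ℝ))) : Set ((Fin n ⊕ Fin m) → ℝ) :=
  pairSet T ∩ unitSphere (Fin n ⊕ Fin m)

/-- The extended map `(a, b) ↦ A a + √m · b`. -/
def extMap {m n : ℕ} (A : Matrix (Fin m) (Fin n) ℝ) (p : (Fin n → ℝ) × (Fin m → ℝ)) :
    Fin m → ℝ :=
  A.mulVec p.1 + Real.sqrt m • p.2

/-- Euclidean norm of a pair, `√(‖a‖₂² + ‖b‖₂²)`. -/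
def pairNorm {n m : ℕ} (p : (Fin n → ℝ) × (Fin m → ℝ)) : ℝ :=
  Real.sqrt (sqNorm p.1 + sqNorm p.2)

/-- `f` is a norm on `ι → ℝ`. -/
structure IsNorm {ι : Type*} [Fintype ι] (f : (ι → ℝ) → ℝ) : Prop where
  eq_zero_iff : ∀ x, f x = 0 ↔ x = 0
  smul : ∀ (c : ℝ) (x), f (c • x) = |c| * f x
  triangle : ∀ x y, f (x + y) ≤ f x + f y

/-- Tangent cone (cone of descent directions) of `f` at `x`. -/
def tangentCone' {ι : Type*} [Fintype ι] (f : (ι → ℝ) → ℝ) (x : ι → ℝ) : Set (ι → ℝ) :=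
  {u | ∃ t : ℝ, 0 < t ∧ f (x + t • u) ≤ f x}

/-- Subdifferential of `f` at `x`. -/
def subdiff {ι : Type*} [Fintype ι] (f : (ι → ℝ) → ℝ) (x : ι → ℝ) : Set (ι → ℝ) :=
  {u | ∀ d, f x + dotp u d ≤ f (x + d)}

/-- Dual norm `f*(d) = sup {⟨u, d⟩ : f(u) ≤ 1}`. -/
def dualNorm {ι : Type*} [Fintype ι] (f : (ι → ℝ) → ℝ) (d : ι → ℝ) : ℝ :=
  sSup ((fun u => dotp u d) '' {u | f u ≤ 1})

/-- Compatibility constant `α_f = sup_{u ≠ 0} f(u)/‖u‖₂`. -/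
def compatConst {ι : Type*} [Fintype ι] (f : (ι → ℝ) → ℝ) : ℝ :=
  sSup ((fun u => f u / eNorm u) '' {u | u ≠ 0})

end

noncomputable section

/-- Operator (ℓ₂ → ℓ₂) norm of a square matrix. -/
def opNorm {n : ℕ} (M : Matrix (Fin n) (Fin n) ℝ) : ℝ :=
  sSup ((fun x => eNorm (M.mulVec x)) '' {x : Fin n → ℝ | eNorm x ≤ 1})

end

section Euclidean

variable {ι : Type*} [Fintype ι]

lemma sqNorm_nonneg (x : ι → ℝ) : 0 ≤ sqNorm x :=
  Finset.sum_nonneg fun i _ => sq_nonneg (x i)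

lemma eNorm_pos {x : ι → ℝ} (hx : x ≠ 0) : 0 < eNorm x := by
  obtain ⟨i, hi⟩ := Function.ne_iff.mp hx
  exact Real.sqrt_pos.mpr (Finset.sum_pos' (fun j _ => sq_nonneg (x j))
    ⟨i, Finset.mem_univ i, by simpa using sq_pos_of_ne_zero hi⟩)

lemma abs_le_eNorm (x : ι → ℝ) (i : ι) : |x i| ≤ eNorm x :=
  Real.abs_le_sqrt (Finset.single_le_sum (f := fun i => x i ^ 2)
    (fun j _ => sq_nonneg (x j)) (Finset.mem_univ i))

lemma dotp_le_sqrt_mul_sqrt (x y : ι → ℝ) :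
    dotp x y ≤ Real.sqrt (sqNorm x) * Real.sqrt (sqNorm y) :=
  Real.sum_mul_le_sqrt_mul_sqrt Finset.univ x y

lemma dotp_neg_left (x y : ι → ℝ) : dotp (-x) y = -dotp x y := by
  simp [dotp]

lemma dotp_sub_smul_left (x u a : ι → ℝ) (c : ℝ) :
    dotp (x - c • u) a = dotp x a - c * dotp a u := by
  simp only [dotp, Pi.sub_apply, Pi.smul_apply, smul_eq_mul, sub_mul, Finset.sum_sub_distrib,
    Finset.mul_sum]
  congr 1
  exact Finset.sum_congr rfl fun i _ => by ring

end Euclidean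

section Norms

variable {ι : Type*} [Fintype ι] {f : (ι → ℝ) → ℝ}

lemma IsNorm.map_zero (hf : IsNorm f) : f 0 = 0 := (hf.eq_zero_iff 0).mpr rfl

lemma IsNorm.nonneg (hf : IsNorm f) (x : ι → ℝ) : 0 ≤ f x := by
  have h := hf.triangle x ((-1 : ℝ) • x)
  rw [hf.smul] at h
  simp [hf.map_zero] at h
  exact h

lemma IsNorm.sum_le (hf : IsNorm f) {κ : Type*} (s : Finset κ) (v : κ → ι → ℝ) :
    f (∑ k ∈ s, v k) ≤ ∑ k ∈ s, f (v k) :=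
  Finset.le_sum_of_subadditive f hf.map_zero.le hf.triangle s v

lemma IsNorm.exists_le_mul_eNorm (hf : IsNorm f) : ∃ C, ∀ x, f x ≤ C * eNorm x := by
  classical
  refine ⟨∑ i, f (Pi.single i 1), fun x => ?_⟩
  calc f x = f (∑ i, x i • Pi.single i (1 : ℝ)) := by
        congr 1
        ext j
        simp [Finset.sum_apply, Pi.single_apply]
    _ ≤ ∑ i, f (x i • Pi.single i (1 : ℝ)) := hf.sum_le _ _
    _ ≤ ∑ i, f (Pi.single i 1) * eNorm x := by
        refine Finset.sum_le_sum fun i _ => ?_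
        rw [hf.smul, mul_comm]
        exact mul_le_mul_of_nonneg_left (abs_le_eNorm x i) (hf.nonneg _)
    _ = _ := by rw [Finset.sum_mul]

lemma IsNorm.le_compatConst_mul_eNorm (hf : IsNorm f) (x : ι → ℝ) :
    f x ≤ compatConst f * eNorm x := by
  obtain ⟨C, hC⟩ := hf.exists_le_mul_eNorm
  rcases eq_or_ne x 0 with rfl | hx
  · simp [hf.map_zero, eNorm, sqNorm]
  · rw [← div_le_iff₀ (eNorm_pos hx)]
    refine le_csSup ⟨C, ?_⟩ ⟨x, hx, rfl⟩
    rintro _ ⟨u, hu, rfl⟩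
    exact (div_le_iff₀ (eNorm_pos hu)).mpr (hC u)

/-- Norms are subdifferentiable everywhere, by the Hahn–Banach theorem. -/
lemma IsNorm.subdiff_nonempty (hf : IsNorm f) (x : ι → ℝ) : (subdiff f x).Nonempty := by
  classical
  have H : ∀ c : ℝ, c • x = 0 → RingHom.id ℝ c • f x = 0 := by
    intro c hc
    rcases smul_eq_zero.mp hc with h | h
    · simp [h]
    · simp [h, hf.map_zero]
  obtain ⟨φ, hφx, hφ⟩ := exists_extension_of_le_sublinear
    (LinearPMap.mkSpanSingleton' x (f x) H) f
    (fun c hc y => by rw [hf.smul, abs_of_pos hc]) hf.triangle (by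
      rintro ⟨y, hy⟩
      obtain ⟨c, rfl⟩ := Submodule.mem_span_singleton.mp hy
      rw [LinearPMap.mkSpanSingleton'_apply, hf.smul]
      exact mul_le_mul_of_nonneg_right (le_abs_self c) (hf.nonneg x))
  have hx : φ x = f x :=
    (hφx ⟨x, Submodule.mem_span_singleton_self x⟩).trans
      (LinearPMap.mkSpanSingleton'_apply_self x (f x) H _)
  refine ⟨fun i => φ (Pi.single i 1), fun d => ?_⟩
  have hd : dotp (fun i => φ (Pi.single i 1)) d = φ d := by
    rw [LinearMap.pi_apply_eq_sum_univ φ d]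
    refine Finset.sum_congr rfl fun i _ => ?_
    have he : (Pi.single i 1 : ι → ℝ) = fun j => if i = j then 1 else 0 := by
      ext j
      simp [Pi.single_apply, eq_comm]
    rw [smul_eq_mul, mul_comm, ← he]
  rw [hd, ← hx, ← map_add]
  exact hφ _

end Norms

section GaussianMeasure

variable {ι : Type*} [Fintype ι]

instance : IsProbabilityMeasure (_root_.stdGaussian ι) := by
  unfold _root_.stdGaussian
  infer_instance

lemma memLp_eval_stdGaussian (i : ι) : MemLp (fun z => z i) 2 (_root_.stdGaussian ι) :=
  (memLp_id_gaussianReal' 2 (by simp)).comp_measurePreserving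
    (measurePreserving_eval (fun _ : ι => gaussianReal 0 1) i)

lemma measurePreserving_neg_stdGaussian :
    MeasurePreserving (fun z : ι → ℝ => -z) (_root_.stdGaussian ι) (_root_.stdGaussian ι) :=
  measurePreserving_pi (fun _ : ι => gaussianReal 0 1) (fun _ : ι => gaussianReal 0 1)
    (f := fun _ x => -x) fun _ => ⟨measurable_neg, by simp [gaussianReal_map_neg]⟩

lemma memLp_dotp_stdGaussian (y : ι → ℝ) :
    MemLp (fun z => dotp z y) 2 (_root_.stdGaussian ι) :=
  memLp_finsetSum _ fun i _ => (memLp_eval_stdGaussian i).mul_const (y i)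

lemma integral_dotp_sq_stdGaussian (y : ι → ℝ) :
    ∫ z, dotp z y ^ 2 ∂(_root_.stdGaussian ι) = sqNorm y := by
  have hmean : ∫ z, dotp z y ∂(_root_.stdGaussian ι) = 0 := by
    have h := (measurePreserving_neg_stdGaussian (ι := ι)).integral_comp
      (MeasurableEquiv.neg (ι → ℝ)).measurableEmbedding (fun z => dotp z y)
    simp only [dotp_neg_left, integral_neg] at h
    linarith
  have hvar : Var[fun z => dotp z y; _root_.stdGaussian ι] = sqNorm y := by
    have h := variance_sum_pi (μ := fun _ : ι => gaussianReal 0 1)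
      (X := fun i x => y i * id x)
      (fun i => (memLp_id_gaussianReal' 2 (by simp)).const_mul (y i))
    simp only [variance_const_mul, variance_id_gaussianReal, NNReal.coe_one, mul_one] at h
    rw [sqNorm, ← h, _root_.stdGaussian]
    congr 1
    ext z
    simp [dotp, Finset.sum_apply, mul_comm]
  rw [← hvar, variance_of_integral_eq_zero (memLp_dotp_stdGaussian y).aemeasurable hmean]

lemma integral_abs_dotp_stdGaussian_le_one {y : ι → ℝ} (hy : sqNorm y = 1) :
    ∫ z, |dotp z y| ∂(_root_.stdGaussian ι) ≤ 1 := by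
  have hsq := (memLp_dotp_stdGaussian y).integrable_sq
  calc ∫ z, |dotp z y| ∂(_root_.stdGaussian ι)
      ≤ ∫ z, (1 + dotp z y ^ 2) / 2 ∂(_root_.stdGaussian ι) := by
        refine integral_mono ((memLp_dotp_stdGaussian y).integrable (by norm_num)).abs
          (((integrable_const _).add hsq).div_const 2) fun z => ?_
        have := sq_nonneg (|dotp z y| - 1)
        have h2 := sq_abs (dotp z y)
        dsimp only
        nlinarith
    _ = 1 := by
        rw [integral_div, integral_add (integrable_const _) hsq, integral_dotp_sq_stdGaussian, hy]
        simp

lemma integrable_sqNorm_sub_stdGaussian (u : ι → ℝ) :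
    Integrable (fun z => sqNorm (z - u)) (_root_.stdGaussian ι) :=
  integrable_finsetSum _ fun i _ =>
    ((memLp_eval_stdGaussian i).sub (memLp_const (u i))).integrable_sq

lemma measurePreserving_comp_inl_stdGaussian {κ : Type*} [Fintype κ] :
    MeasurePreserving (fun (z : ι ⊕ κ → ℝ) i => z (Sum.inl i))
      (_root_.stdGaussian (ι ⊕ κ)) (_root_.stdGaussian ι) :=
  measurePreserving_fst.comp
    (measurePreserving_sumPiEquivProdPi (fun _ : ι ⊕ κ => gaussianReal 0 1))

lemma measurePreserving_comp_inr_stdGaussian {κ : Type*} [Fintype κ] :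
    MeasurePreserving (fun (z : ι ⊕ κ → ℝ) i => z (Sum.inr i))
      (_root_.stdGaussian (ι ⊕ κ)) (_root_.stdGaussian κ) :=
  measurePreserving_snd.comp
    (measurePreserving_sumPiEquivProdPi (fun _ : ι ⊕ κ => gaussianReal 0 1))

end GaussianMeasure

section InfSqDist

variable {ι : Type*} [Fintype ι]

/-- Squared Euclidean distance from `z` to the set `K`. -/
noncomputable def infSqDist (K : Set (ι → ℝ)) (z : ι → ℝ) : ℝ :=
  sInf ((fun u => sqNorm (z - u)) '' K)

lemma bddBelow_sqNorm_sub_image (K : Set (ι → ℝ)) (z : ι → ℝ) :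
    BddBelow ((fun u => sqNorm (z - u)) '' K) :=
  ⟨0, by rintro _ ⟨u, -, rfl⟩; exact sqNorm_nonneg _⟩

lemma infSqDist_nonneg (K : Set (ι → ℝ)) (z : ι → ℝ) : 0 ≤ infSqDist K z :=
  Real.sInf_nonneg (by rintro _ ⟨u, -, rfl⟩; exact sqNorm_nonneg _)

lemma infSqDist_le {K : Set (ι → ℝ)} {u : ι → ℝ} (hu : u ∈ K) (z : ι → ℝ) :
    infSqDist K z ≤ sqNorm (z - u) :=
  csInf_le (bddBelow_sqNorm_sub_image K z) ⟨u, hu, rfl⟩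

lemma exists_sqNorm_sub_lt {K : Set (ι → ℝ)} (hK : K.Nonempty) (z : ι → ℝ) {ε : ℝ} (hε : 0 < ε) :
    ∃ u ∈ K, sqNorm (z - u) < infSqDist K z + ε := by
  obtain ⟨_, ⟨u, hu, rfl⟩, h⟩ := exists_lt_of_csInf_lt (hK.image fun u => sqNorm (z - u))
    (lt_add_of_pos_right (infSqDist K z) hε)
  exact ⟨u, hu, h⟩

lemma measurable_infSqDist (K : Set (ι → ℝ)) : Measurable (infSqDist K) := by
  have h : infSqDist K = fun z => ⨅ u : K, sqNorm (z - (u : ι → ℝ)) := by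
    ext z
    rw [infSqDist, sInf_image']
  rw [h]
  refine (upperSemicontinuous_ciInf (fun z => ?_) fun u => ?_).measurable
  · exact ⟨0, by rintro _ ⟨u, rfl⟩; exact sqNorm_nonneg _⟩
  · refine Continuous.upperSemicontinuous ?_
    unfold sqNorm
    fun_prop

lemma integrable_infSqDist_stdGaussian {K : Set (ι → ℝ)} (hK : K.Nonempty) :
    Integrable (infSqDist K) (_root_.stdGaussian ι) := by
  obtain ⟨u, hu⟩ := hK
  refine (integrable_sqNorm_sub_stdGaussian u).mono'
    (measurable_infSqDist K).aestronglyMeasurable (.of_forall fun z => ?_)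
  rw [Real.norm_of_nonneg (infSqDist_nonneg K z)]
  exact infSqDist_le hu z

end InfSqDist

lemma integrable_sqrt {Ω : Type*} [MeasurableSpace Ω] {μ : Measure Ω} [IsFiniteMeasure μ]
    {Z : Ω → ℝ} (hZ : Integrable Z μ) (h0 : ∀ ω, 0 ≤ Z ω) :
    Integrable (fun ω => Real.sqrt (Z ω)) μ := by
  refine ((integrable_const (1 : ℝ)).add hZ).mono'
    hZ.aestronglyMeasurable.aemeasurable.sqrt.aestronglyMeasurable (.of_forall fun ω => ?_)
  rw [Real.norm_of_nonneg (Real.sqrt_nonneg _)]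
  exact Real.sqrt_le_iff.mpr ⟨add_nonneg zero_le_one (h0 ω), by
    simp only [Pi.add_apply]
    nlinarith [h0 ω, sq_nonneg (Z ω)]⟩

lemma integral_sqrt_le {Ω : Type*} [MeasurableSpace Ω] {μ : Measure Ω} [IsProbabilityMeasure μ]
    {Z : Ω → ℝ} (hZ : Integrable Z μ) (h0 : ∀ ω, 0 ≤ Z ω) :
    ∫ ω, Real.sqrt (Z ω) ∂μ ≤ Real.sqrt (∫ ω, Z ω ∂μ) :=
  Real.strictConcaveOn_sqrt.concaveOn.le_map_integral Real.continuous_sqrt.continuousOn isClosed_Ici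
    (.of_forall h0) hZ (integrable_sqrt hZ h0)

/-- If the support function of a set `T` of unit vectors is dominated by an integrable `ψ`, then the Gaussian
complexity of `T` is at most `2 E ψ + 1`. -/
lemma gaussComplexity_le_of_dotp_le {ι : Type*} [Fintype ι] {T : Set (ι → ℝ)}
    (hT : T ⊆ unitSphere ι) {ψ : (ι → ℝ) → ℝ} (hψ : Integrable ψ (_root_.stdGaussian ι))
    (hψ0 : ∀ z, 0 ≤ ψ z) (h : ∀ z, ∀ x ∈ T, dotp z x ≤ ψ z) :
    gaussComplexity T ≤ 2 * ∫ z, ψ z ∂(_root_.stdGaussian ι) + 1 := by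
  rcases T.eq_empty_or_nonempty with rfl | ⟨y, hy⟩
  · have := integral_nonneg (μ := _root_.stdGaussian ι) (f := ψ) hψ0
    simp only [gaussComplexity, Set.image_empty, Real.sSup_empty, integral_zero]
    linarith
  have hneg : Integrable (fun z => ψ (-z)) (_root_.stdGaussian ι) :=
    (measurePreserving_neg_stdGaussian (ι := ι)).integrable_comp_of_integrable hψ
  have habs : Integrable (fun z => |dotp z y|) (_root_.stdGaussian ι) :=
    ((memLp_dotp_stdGaussian y).integrable (by norm_num)).abs
  have hsum : Integrable (fun z => ψ z + ψ (-z)) (_root_.stdGaussian ι) := hψ.add hneg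
  calc gaussComplexity T
      ≤ ∫ z, (ψ z + ψ (-z) + |dotp z y|) ∂(_root_.stdGaussian ι) := by
        refine integral_mono_of_nonneg (.of_forall fun z => ?_) (hsum.add habs)
          (.of_forall fun z => ?_)
        · exact Real.sSup_nonneg (by rintro _ ⟨x, -, rfl⟩; exact abs_nonneg _)
        · refine csSup_le (Set.Nonempty.image _ ⟨y, hy⟩) ?_
          rintro _ ⟨x, hx, rfl⟩
          have h1 := h z x hx
          have h2 := h (-z) x hx
          rw [dotp_neg_left] at h2
          have := hψ0 z
          have := hψ0 (-z)
          have := abs_nonneg (dotp z y)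
          exact abs_le.mpr ⟨by linarith, by linarith⟩
    _ = 2 * ∫ z, ψ z ∂(_root_.stdGaussian ι) + ∫ z, |dotp z y| ∂(_root_.stdGaussian ι) := by
        rw [integral_add hsum habs, integral_add hψ hneg,
          (measurePreserving_neg_stdGaussian (ι := ι)).integral_comp
            (MeasurableEquiv.neg (ι → ℝ)).measurableEmbedding ψ]
        ring
    _ ≤ _ := by
        gcongr
        exact integral_abs_dotp_stdGaussian_le_one (hT hy)

lemma add_mul_le_sqrt_mul_sqrt (a b c d : ℝ) :
    a * c + b * d ≤ Real.sqrt (a ^ 2 + b ^ 2) * Real.sqrt (c ^ 2 + d ^ 2) := by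
  simpa [Fin.sum_univ_two] using Real.sum_mul_le_sqrt_mul_sqrt Finset.univ ![a, b] ![c, d]

/-- **Gaussian complexity bound for the fully penalized error cone.** -/
theorem gauss_complexity_fully_penalized_cone {n m : ℕ}
    (f : (Fin n → ℝ) → ℝ) (g : (Fin m → ℝ) → ℝ) (hf : IsNorm f) (hg : IsNorm g)
    (xs : Fin n → ℝ) (vs : Fin m → ℝ) (τ₁ τ₂ β : ℝ)
    (hτ₁ : 0 < τ₁) (hτ₂ : 0 < τ₂) (hβ : 1 < β)
    (C₃ : Set ((Fin n → ℝ) × (Fin m → ℝ)))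
    (hC₃ : C₃ = {p | ∀ u ∈ subdiff f xs, ∀ s ∈ subdiff g vs,
      τ₁ * dotp p.1 u + τ₂ * dotp p.2 s ≤ (1 / β) * (τ₁ * f p.1 + τ₂ * g p.2)}) :
    gaussComplexity (sphPair C₃) ≤
      2 * (Real.sqrt (gaussSqDist ((fun u => τ₁ • u) '' subdiff f xs) +
            gaussSqDist ((fun s => τ₂ • s) '' subdiff g vs)) +
          Real.sqrt ((τ₁ * compatConst f) ^ 2 + (τ₂ * compatConst g) ^ 2) / β) + 1 := by
  subst hC₃
  set K := (fun u => τ₁ • u) '' subdiff f xs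
  set L := (fun s => τ₂ • s) '' subdiff g vs
  set R := Real.sqrt ((τ₁ * compatConst f) ^ 2 + (τ₂ * compatConst g) ^ 2)
  have hKne : K.Nonempty := (hf.subdiff_nonempty xs).image _
  have hLne : L.Nonempty := (hg.subdiff_nonempty vs).image _
  let D : (Fin n ⊕ Fin m → ℝ) → ℝ := fun z =>
    infSqDist K (fun i => z (Sum.inl i)) + infSqDist L (fun i => z (Sum.inr i))
  have hD0 : ∀ z, 0 ≤ D z := fun z => add_nonneg (infSqDist_nonneg _ _) (infSqDist_nonneg _ _)
  have hDK := (measurePreserving_comp_inl_stdGaussian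
    (ι := Fin n) (κ := Fin m)).integrable_comp_of_integrable (integrable_infSqDist_stdGaussian hKne)
  have hDL := (measurePreserving_comp_inr_stdGaussian
    (ι := Fin n) (κ := Fin m)).integrable_comp_of_integrable (integrable_infSqDist_stdGaussian hLne)
  have hD : Integrable D (_root_.stdGaussian _) := hDK.add hDL
  have hDint : ∫ z, D z ∂(_root_.stdGaussian _) = gaussSqDist K + gaussSqDist L := by
    rw [show gaussSqDist K = ∫ x, infSqDist K x ∂(_root_.stdGaussian _) from rfl,
      show gaussSqDist L = ∫ x, infSqDist L x ∂(_root_.stdGaussian _) from rfl,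
      ← (measurePreserving_comp_inl_stdGaussian (ι := Fin n) (κ := Fin m)).map_eq,
      ← (measurePreserving_comp_inr_stdGaussian (ι := Fin n) (κ := Fin m)).map_eq,
      integral_map measurePreserving_comp_inl_stdGaussian.aemeasurable
        (measurable_infSqDist K).aestronglyMeasurable,
      integral_map measurePreserving_comp_inr_stdGaussian.aemeasurable
        (measurable_infSqDist L).aestronglyMeasurable]
    exact integral_add hDK hDL
  have hsqrt := integrable_sqrt hD hD0
  have hRβ : 0 ≤ R / β := by positivity
  refine (gaussComplexity_le_of_dotp_le (ψ := fun z => Real.sqrt (D z) + R / β)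
    Set.inter_subset_right (hsqrt.add (integrable_const _))
    (fun z => add_nonneg (Real.sqrt_nonneg _) hRβ) ?_).trans ?_
  · rintro z _ ⟨⟨⟨a, b⟩, hab, rfl⟩, hunit⟩
    have hnorm : sqNorm a + sqNorm b = 1 := by
      simpa [unitSphere, sqNorm, pairVec] using hunit
    have hsplit : dotp z (pairVec (a, b)) =
        dotp (fun i => z (Sum.inl i)) a + dotp (fun i => z (Sum.inr i)) b := by
      simp [dotp, pairVec]
    have hpen : τ₁ * f a + τ₂ * g b ≤ R := by
      have h := add_mul_le_sqrt_mul_sqrt (τ₁ * compatConst f) (τ₂ * compatConst g)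
        (eNorm a) (eNorm b)
      rw [eNorm, eNorm, Real.sq_sqrt (sqNorm_nonneg a), Real.sq_sqrt (sqNorm_nonneg b), hnorm,
        Real.sqrt_one, mul_one] at h
      have h1 := mul_le_mul_of_nonneg_left (hf.le_compatConst_mul_eNorm a) hτ₁.le
      have h2 := mul_le_mul_of_nonneg_left (hg.le_compatConst_mul_eNorm b) hτ₂.le
      simp only [eNorm] at h1 h2
      linarith
    have hpen' : (1 / β) * (τ₁ * f a + τ₂ * g b) ≤ R / β := by
      rw [one_div_mul_eq_div]
      gcongr
    have hε : ∀ ε : ℝ, 0 < ε → dotp z (pairVec (a, b)) - R / β ≤ Real.sqrt (D z + ε) := by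
      intro ε hε
      obtain ⟨_, ⟨u, hu, rfl⟩, hu'⟩ :=
        exists_sqNorm_sub_lt hKne (fun i => z (Sum.inl i)) (half_pos hε)
      obtain ⟨_, ⟨s, hs, rfl⟩, hs'⟩ :=
        exists_sqNorm_sub_lt hLne (fun i => z (Sum.inr i)) (half_pos hε)
      have hcone := hab u hu s hs
      have h1 := dotp_le_sqrt_mul_sqrt ((fun i => z (Sum.inl i)) - τ₁ • u) a
      have h2 := dotp_le_sqrt_mul_sqrt ((fun i => z (Sum.inr i)) - τ₂ • s) b
      have h3 := add_mul_le_sqrt_mul_sqrt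
        (Real.sqrt (sqNorm ((fun i => z (Sum.inl i)) - τ₁ • u)))
        (Real.sqrt (sqNorm ((fun i => z (Sum.inr i)) - τ₂ • s)))
        (Real.sqrt (sqNorm a)) (Real.sqrt (sqNorm b))
      simp only [Real.sq_sqrt (sqNorm_nonneg _), hnorm, Real.sqrt_one, mul_one] at h3
      have h4 := Real.sqrt_le_sqrt (show sqNorm ((fun i => z (Sum.inl i)) - τ₁ • u) +
        sqNorm ((fun i => z (Sum.inr i)) - τ₂ • s) ≤ D z + ε by
          simp only [D]; linarith)
      rw [dotp_sub_smul_left] at h1 h2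
      rw [hsplit]
      dsimp only at hcone
      linarith
    have hlim : Filter.Tendsto (fun ε => Real.sqrt (D z + ε)) (nhdsWithin 0 (Set.Ioi 0))
        (nhds (Real.sqrt (D z))) := by
      have : Continuous fun ε => Real.sqrt (D z + ε) := by fun_prop
      simpa using (this.tendsto 0).mono_left nhdsWithin_le_nhds
    have := ge_of_tendsto hlim (eventually_nhdsWithin_of_forall hε)
    linarith
  · rw [integral_add hsqrt (integrable_const _), ← hDint]
    have := integral_sqrt_le hD hD0
    simp only [integral_const, probReal_univ, one_smul]
    linarith
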